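/- arXiv:1906.06976 — 2 statements merged into one kernel-verified Lean document; each statement's English description precedes it below -/
import Mathlib

section
/- Let d ≥ 1, let Λ ⊂ ℤ^d be a finite cube, let λ > 0 and E, Ẽ ∈ ℝ. Let T ∈ ℝ^{Λ×Λ} be symmetric with T_{jk} ≥ 0 for all j,k and Σ_j T_{jk} > 0 for every k. Let {W_k}_{k∈Λ} be i.i.d. standard Cauchy random variables, set V_j = Σ_{k∈Λ} T_{jk} W_k and H_Λ = −Δ + λV. Then lim_{ε→0⁺} E[ det((E+iε)·1_Λ − H_Λ) / det((Ẽ+iε)·1_Λ − H_Λ) ] = det(E·1_Λ + iλT̂ − H₀) / det(Ẽ·1_Λ + iλT̂ − H₀), where H₀ = −Δ and T̂ is the diagonal matrix with entries T̂_{jj} = Σ_{k∈Λ} T_{jk}. -/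
open MeasureTheory Matrix Filter

noncomputable section

/-- ℓ¹ distance on ℤ^d. -/
def dist1 {d : ℕ} (x y : Fin d → ℤ) : ℤ := ∑ i, |x i - y i|

/-- The cube [-L, L]^d in ℤ^d, centered at the origin. -/
def cube (d L : ℕ) : Finset (Fin d → ℤ) :=
  Finset.Icc (fun _ => -(L : ℤ)) (fun _ => (L : ℤ))

/-- Entries of the discrete Laplacian associated to a finite volume Λ:
`(Δψ)(j) = ∑_{k ∈ Λ, |j-k|₁ = 1} (ψ(k) - ψ(j))`. -/
def lapE {d : ℕ} (Λ : Finset (Fin d → ℤ)) (j k : Fin d → ℤ) : ℂ :=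
  (if dist1 j k = 1 then 1 else 0) -
    (if j = k then ((Λ.filter (fun k' => dist1 j k' = 1)).card : ℂ) else 0)

/-- The discrete Laplacian as a matrix on Λ. -/
def lap {d : ℕ} (Λ : Finset (Fin d → ℤ)) : Matrix Λ Λ ℂ :=
  fun j k => lapE Λ (j : Fin d → ℤ) (k : Fin d → ℤ)

/-- The standard Cauchy probability measure π⁻¹(1+x²)⁻¹ dx on ℝ. -/
def cauchy : Measure ℝ :=
  volume.withDensity (fun x => ENNReal.ofReal (1 / (Real.pi * (1 + x ^ 2))))



instance cauchy_isProb : IsProbabilityMeasure cauchy := by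
  constructor
  unfold cauchy
  rw [withDensity_apply _ MeasurableSet.univ, Measure.restrict_univ,
    ← ofReal_integral_eq_lintegral_ofReal]
  · have : ∀ x : ℝ, 1 / (Real.pi * (1 + x ^ 2)) = Real.pi⁻¹ * (1 + x ^ 2)⁻¹ := by
      intro x; rw [one_div, mul_inv]
    simp_rw [this]
    rw [integral_const_mul, integral_univ_inv_one_add_sq, inv_mul_cancel₀ Real.pi_ne_zero]
    simp
  · have : ∀ x : ℝ, 1 / (Real.pi * (1 + x ^ 2)) = Real.pi⁻¹ * (1 + x ^ 2)⁻¹ := by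
      intro x; rw [one_div, mul_inv]
    simp_rw [this]
    exact integrable_inv_one_add_sq.const_mul _
  · filter_upwards with x
    have := Real.pi_pos
    positivity

lemma integral_cauchy (f : ℝ → ℂ) :
    ∫ x, f x ∂cauchy = ∫ x : ℝ, ((1 / (Real.pi * (1 + x ^ 2)) : ℝ) : ℂ) * f x := by
  unfold cauchy
  rw [integral_withDensity_eq_integral_toReal_smul (by fun_prop) (by simp)]
  refine integral_congr_ae ?_
  filter_upwards with x
  have := Real.pi_pos
  rw [ENNReal.toReal_ofReal (by positivity)]
  simp

lemma integrable_cauchy_of {X : Type*} [MeasurableSpace X] [TopologicalSpace X]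
    [OpensMeasurableSpace X] [SecondCountableTopology X] (μ : Measure X) [IsFiniteMeasure μ]
    {f : X → ℂ} (hf : Continuous f) {C : ℝ} (hC : ∀ x, ‖f x‖ ≤ C) : Integrable f μ :=
  Integrable.of_bound hf.aestronglyMeasurable C (Eventually.of_forall hC)

/-- one-variable mean value property -/
lemma cauchy_mean {f : ℂ → ℂ} {U : Set ℂ} (hU : IsOpen U) (hsub : ∀ w : ℂ, w.im ≤ 0 → w ∈ U)
    (hf : DifferentiableOn ℂ f U) {C : ℝ} (hC : ∀ w : ℂ, w.im ≤ 0 → ‖f w‖ ≤ C) :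
    ∫ x : ℝ, f x ∂cauchy = f (-Complex.I) := by
  have hC0 : 0 ≤ C := (norm_nonneg _).trans (hC 0 (by simp))
  set g : ℂ → ℂ := fun w => dslope f (-Complex.I) w / (w - Complex.I) with hg
  have hgd : DifferentiableOn ℂ g {w : ℂ | w.im ≤ 0} := by
    have h1 : DifferentiableOn ℂ (dslope f (-Complex.I)) U :=
      (Complex.differentiableOn_dslope (hU.mem_nhds (hsub _ (by simp)))).2 hf
    refine DifferentiableOn.div (h1.mono hsub) (by fun_prop) ?_
    intro w hw h
    have : w = Complex.I := by linear_combination h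
    simp [this] at hw
    linarith
  have hgeq : ∀ w : ℂ, w ≠ -Complex.I → g w = (f w - f (-Complex.I)) / (w ^ 2 + 1) := by
    intro w hw
    simp only [hg]
    rw [dslope_of_ne _ hw, slope_def_field, div_div]
    congr 1
    linear_combination (-1 : ℂ) * Complex.I_mul_I
  have hreal : ∀ x : ℝ, g x = (f x - f (-Complex.I)) / (x ^ 2 + 1) := by
    intro x
    apply hgeq
    intro h
    have := congrArg Complex.im h
    simp at this
  have hcont : Continuous fun x : ℝ => f x := by
    rw [continuous_iff_continuousAt]
    intro x
    have hx : ContinuousAt f (x : ℂ) :=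
      hf.continuousOn.continuousAt (hU.mem_nhds (hsub _ (by simp)))
    exact ContinuousAt.comp (f := fun x : ℝ => (x : ℂ)) hx Complex.continuous_ofReal.continuousAt
  have hbd : ∀ (R : ℝ), 2 ≤ R → ∀ w : ℂ, w.im ≤ 0 → R ≤ ‖w‖ → ‖g w‖ ≤ 4 * C / R ^ 2 := by
    intro R hR w hw hwR
    have hne : w ≠ -Complex.I := by
      rintro rfl
      simp at hwR
      linarith
    rw [hgeq w hne, norm_div]
    have h1 : ‖f w - f (-Complex.I)‖ ≤ 2 * C := by
      refine (norm_sub_le _ _).trans ?_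
      have := hC w hw
      have := hC (-Complex.I) (by simp)
      linarith
    have h2 : R ^ 2 / 2 ≤ ‖w ^ 2 + 1‖ := by
      have h3 : ‖w ^ 2‖ ≤ ‖w ^ 2 + 1‖ + 1 := by
        have := norm_sub_le (w ^ 2 + 1) 1
        simpa using this
      rw [norm_pow] at h3
      nlinarith
    calc _ ≤ (2 * C) / (R ^ 2 / 2) := by
            apply div_le_div₀ (by linarith) h1 (by positivity) h2
      _ = _ := by field_simp; ring
  have hint : Integrable fun x : ℝ => g x := by
    have : Integrable fun x : ℝ => (1 + x ^ 2)⁻¹ * (2 * C) := integrable_inv_one_add_sq.mul_const _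
    refine this.mono' ?_ ?_
    · apply Continuous.aestronglyMeasurable
      simp_rw [hreal]
      refine Continuous.div (hcont.sub continuous_const) (by fun_prop) ?_
      intro x h
      have h' : ((x ^ 2 + 1 : ℝ) : ℂ) = 0 := by push_cast; exact h
      have h'' : x ^ 2 + 1 = 0 := by exact_mod_cast h'
      nlinarith
    · filter_upwards with x
      rw [hreal, norm_div]
      have e : ‖(x : ℂ) ^ 2 + 1‖ = 1 + x ^ 2 := by
        have : (x : ℂ) ^ 2 + 1 = ((1 + x ^ 2 : ℝ) : ℂ) := by push_cast; ring
        rw [this, Complex.norm_real, Real.norm_of_nonneg (by positivity)]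
      rw [e, div_eq_inv_mul]
      gcongr
      refine (norm_sub_le _ _).trans ?_
      have := hC x (by simp)
      have := hC (-Complex.I) (by simp)
      linarith
  have hlim : Tendsto (fun R : ℝ => ∫ x in (-R)..R, g x) atTop (nhds (∫ x : ℝ, g x)) :=
    intervalIntegral_tendsto_integral hint tendsto_neg_atTop_atBot tendsto_id
  have hlim0 : Tendsto (fun R : ℝ => ∫ x in (-R)..R, g x) atTop (nhds 0) := by
    have hb : Tendsto (fun R : ℝ => 16 * C / R) atTop (nhds 0) :=
      tendsto_const_nhds.div_atTop tendsto_id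
    refine squeeze_zero_norm' ?_ hb
    filter_upwards [eventually_ge_atTop 2] with R hR
    have key := Complex.integral_boundary_rect_eq_zero_of_differentiableOn g
      (((-R : ℝ) : ℂ) + ((-R : ℝ) : ℂ) * Complex.I) (R : ℂ) (by
        refine hgd.mono ?_
        intro w hw
        rw [Complex.mem_reProdIm] at hw
        have := hw.2
        simp at this
        rw [Set.uIcc_of_le (by linarith)] at this
        exact this.2)
    simp only [Complex.add_re, Complex.add_im, Complex.mul_re, Complex.mul_im, Complex.ofReal_re,
      Complex.ofReal_im, Complex.I_re, Complex.I_im] at key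
    simp only [mul_zero, zero_mul, mul_one, sub_zero, add_zero, zero_add,
      Complex.ofReal_zero] at key
    have b1 : ‖∫ x in (-R)..R, g (x + ((-R : ℝ) : ℂ) * Complex.I)‖
        ≤ 4 * C / R ^ 2 * |R - -R| := by
      apply intervalIntegral.norm_integral_le_of_norm_le_const
      intro x _
      apply hbd R hR _ (by simp; linarith)
      refine le_trans ?_ (Complex.abs_im_le_norm _)
      simp [abs_of_nonneg (by linarith : 0 ≤ R)]
    have b2 : ‖∫ y in (-R)..0, g ((R : ℂ) + y * Complex.I)‖ ≤ 4 * C / R ^ 2 * |0 - -R| := by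
      apply intervalIntegral.norm_integral_le_of_norm_le_const
      intro y hy
      rw [Set.uIoc_of_le (by linarith)] at hy
      apply hbd R hR _ (by simp; linarith [hy.2])
      refine le_trans ?_ (Complex.abs_re_le_norm _)
      simp [abs_of_nonneg (by linarith : 0 ≤ R)]
    have b3 : ‖∫ y in (-R)..0, g (((-R : ℝ) : ℂ) + y * Complex.I)‖
        ≤ 4 * C / R ^ 2 * |0 - -R| := by
      apply intervalIntegral.norm_integral_le_of_norm_le_const
      intro y hy
      rw [Set.uIoc_of_le (by linarith)] at hy
      apply hbd R hR _ (by simp; linarith [hy.2])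
      refine le_trans ?_ (Complex.abs_re_le_norm _)
      simp [abs_of_nonneg (by linarith : 0 ≤ R)]
    rw [abs_of_nonneg (by linarith)] at b1 b2 b3
    have e : (∫ x in (-R)..R, g x) = (∫ x in (-R)..R, g (x + ((-R : ℝ) : ℂ) * Complex.I)) +
        Complex.I * (∫ y in (-R)..0, g ((R : ℂ) + y * Complex.I)) -
        Complex.I * (∫ y in (-R)..0, g (((-R : ℝ) : ℂ) + y * Complex.I)) := by
      simp only [smul_eq_mul] at key
      linear_combination (-1 : ℂ) * key
    rw [e]
    refine (norm_sub_le _ _).trans ?_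
    refine (add_le_add (norm_add_le _ _) le_rfl).trans ?_
    rw [norm_mul, norm_mul, Complex.norm_I, one_mul, one_mul]
    calc _ ≤ 4 * C / R ^ 2 * (R - -R) + 4 * C / R ^ 2 * (0 - -R) + 4 * C / R ^ 2 * (0 - -R) := by
          gcongr
      _ = 16 * C / R := by field_simp; ring
  have h0 : ∫ x : ℝ, g x = 0 := tendsto_nhds_unique hlim hlim0
  have hfi : Integrable (fun x : ℝ => f x) cauchy :=
    integrable_cauchy_of cauchy hcont (C := C) (fun x => hC x (by simp))
  have h1 : ∫ x : ℝ, (f x - f (-Complex.I)) ∂cauchy = 0 := by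
    rw [integral_cauchy]
    have : ∀ x : ℝ, ((1 / (Real.pi * (1 + x ^ 2)) : ℝ) : ℂ) * (f x - f (-Complex.I))
        = (Real.pi : ℂ)⁻¹ * g x := by
      intro x
      rw [hreal]
      push_cast
      rw [one_div, mul_inv, div_eq_mul_inv, add_comm (1 : ℂ)]
      ring
    simp_rw [this]
    rw [integral_const_mul, h0, mul_zero]
  rw [integral_sub hfi (integrable_const _)] at h1
  simpa [sub_eq_zero] using h1

lemma cauchy_mean_fin (n : ℕ) : ∀ {F : (Fin n → ℂ) → ℂ} {U : Set (Fin n → ℂ)} (_ : IsOpen U)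
    (_ : ∀ w : Fin n → ℂ, (∀ k, (w k).im ≤ 0) → w ∈ U)
    (_ : DifferentiableOn ℂ F U) {C : ℝ}
    (_ : ∀ w : Fin n → ℂ, (∀ k, (w k).im ≤ 0) → ‖F w‖ ≤ C),
    ∫ W : Fin n → ℝ, F (fun k => (W k : ℂ)) ∂(Measure.pi fun _ => cauchy)
      = F (fun _ => -Complex.I) := by
  induction n with
  | zero =>
    intro F U hU hsub hF C hC
    have : ∀ W : Fin 0 → ℝ, F (fun k => (W k : ℂ)) = F (fun _ => -Complex.I) := by
      intro W; congr 1; exact Subsingleton.elim _ _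
    simp_rw [this]
    simp
  | succ n ih =>
    intro F U hU hsub hF C hC
    have hcont : Continuous fun W : Fin (n+1) → ℝ => F (fun k => (W k : ℂ)) := by
      rw [continuous_iff_continuousAt]
      intro x
      have hx : ContinuousAt F (fun k => (x k : ℂ)) :=
        hF.continuousOn.continuousAt (hU.mem_nhds (hsub _ (by simp)))
      exact ContinuousAt.comp (f := fun x : Fin (n+1) → ℝ => fun k => (x k : ℂ)) hx
        (Continuous.continuousAt (by fun_prop))
    have hcast : ∀ (x : ℝ) (W : Fin n → ℝ),
        (fun k => ((Fin.cons x W : Fin (n+1) → ℝ) k : ℂ))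
          = (Fin.cons (x : ℂ) (fun k => (W k : ℂ)) : Fin (n+1) → ℂ) := by
      intro x W
      ext k
      refine Fin.cases ?_ (fun i => ?_) k <;> simp
    rw [← ((measurePreserving_piFinSuccAbove (fun _ => cauchy) 0).symm).integral_comp']
    simp_rw [MeasurableEquiv.piFinSuccAbove_symm_apply, Fin.insertNthEquiv]
    simp only [Equiv.coe_fn_mk, Fin.insertNth_zero']
    have hmain : ∀ (p : ℝ × (Fin n → ℝ)), F (fun k => ((Fin.cons p.1 p.2 : Fin (n+1) → ℝ) k : ℂ))
       = F (Fin.cons (p.1 : ℂ) (fun k => (p.2 k : ℂ)) : Fin (n+1) → ℂ) := by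
      intro p; rw [hcast]
    rw [integral_prod_symm]
    · simp_rw [hcast]
      have hstep : ∀ W : Fin n → ℝ,
          ∫ x : ℝ, F (Fin.cons (x : ℂ) (fun k => (W k : ℂ)) : Fin (n+1) → ℂ) ∂cauchy
            = F (Fin.cons (-Complex.I) (fun k => (W k : ℂ)) : Fin (n+1) → ℂ) := by
        intro W
        have hd : Differentiable ℂ
            (fun w : ℂ => (Fin.cons w (fun k => (W k : ℂ)) : Fin (n+1) → ℂ)) := by
          rw [differentiable_pi]
          intro i
          refine Fin.cases ?_ (fun i => ?_) i <;> simp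
        refine cauchy_mean (f := fun w => F (Fin.cons w (fun k => (W k : ℂ)) : Fin (n+1) → ℂ))
          (U := (fun w : ℂ => (Fin.cons w (fun k => (W k : ℂ)) : Fin (n+1) → ℂ)) ⁻¹' U)
          (hU.preimage hd.continuous) ?_ (hF.comp hd.differentiableOn (fun _ h => h)) (C := C) ?_
        · intro w hw
          apply hsub
          intro k
          refine Fin.cases ?_ (fun i => ?_) k <;> simp [hw]
        · intro w hw
          apply hC
          intro k
          refine Fin.cases ?_ (fun i => ?_) k <;> simp [hw]
      rw [integral_congr_ae (Eventually.of_forall hstep)]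
      have hd : Differentiable ℂ
            (fun w : Fin n → ℂ => (Fin.cons (-Complex.I) w : Fin (n+1) → ℂ)) := by
          rw [differentiable_pi]
          intro i
          refine Fin.cases ?_ (fun i => ?_) i
          · simp
          · simp only [Fin.cons_succ]; fun_prop
      have := ih (F := fun w => F (Fin.cons (-Complex.I) w : Fin (n+1) → ℂ))
        (hU.preimage hd.continuous) ?_ (hF.comp hd.differentiableOn (fun _ h => h)) (C := C) ?_
      · rw [this]
        congr 1
        ext k
        refine Fin.cases ?_ (fun i => ?_) k <;> simp
      · intro w hw
        apply hsub
        intro k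
        refine Fin.cases ?_ (fun i => ?_) k <;> simp [hw]
      · intro w hw
        apply hC
        intro k
        refine Fin.cases ?_ (fun i => ?_) k <;> simp [hw]
    · have hc2 : Continuous fun p : ℝ × (Fin n → ℝ) => (Fin.cons p.1 p.2 : Fin (n+1) → ℝ) := by
        rw [continuous_pi_iff]
        intro i
        refine Fin.cases ?_ (fun i => ?_) i
        · simp only [Fin.cons_zero]; fun_prop
        · simp only [Fin.cons_succ]; fun_prop
      exact integrable_cauchy_of _ (hcont.comp hc2) (C := C) (fun p => hC _ (by simp))

lemma cauchy_mean_pi {ι : Type*} [Fintype ι] {F : (ι → ℂ) → ℂ} {U : Set (ι → ℂ)} (hU : IsOpen U)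
    (hsub : ∀ w : ι → ℂ, (∀ k, (w k).im ≤ 0) → w ∈ U)
    (hF : DifferentiableOn ℂ F U) {C : ℝ}
    (hC : ∀ w : ι → ℂ, (∀ k, (w k).im ≤ 0) → ‖F w‖ ≤ C) :
    ∫ W : ι → ℝ, F (fun k => (W k : ℂ)) ∂(Measure.pi fun _ => cauchy)
      = F (fun _ => -Complex.I) := by
  let e := (Fintype.equivFin ι).symm
  rw [← (measurePreserving_piCongrLeft (fun _ => cauchy) e).integral_comp']
  have h : ∀ W : Fin (Fintype.card ι) → ℝ,
      (fun k => ((MeasurableEquiv.piCongrLeft (fun _ : ι => ℝ) e W k : ℝ) : ℂ))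
        = fun k => (W (e.symm k) : ℂ) := by
    intro W
    ext k
    obtain ⟨i, rfl⟩ := e.surjective k
    rw [MeasurableEquiv.piCongrLeft_apply_apply]
    simp
  simp_rw [h]
  have hd : Differentiable ℂ
      (fun w : Fin (Fintype.card ι) → ℂ => fun k : ι => w (e.symm k)) := by
    fun_prop
  exact cauchy_mean_fin _ (F := fun w => F (fun k : ι => w (e.symm k)))
    (hU.preimage hd.continuous) (fun w hw => hsub _ (fun k => hw _))
    (hF.comp hd.differentiableOn (fun _ h => h)) (C := C) (fun w hw => hC _ (fun k => hw _))

section mats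
variable {ι : Type*} [Fintype ι] [DecidableEq ι]

lemma im_quad {A : Matrix ι ι ℂ} (hA : A.IsHermitian) {c : ι → ℂ} {δ : ℝ}
    (hc : ∀ j, δ ≤ (c j).im) (x : ι → ℂ) :
    δ * ∑ j, Complex.normSq (x j) ≤ (star x ⬝ᵥ ((A + diagonal c) *ᵥ x)).im := by
  rw [add_mulVec, dotProduct_add, Complex.add_im]
  have h1 : (star x ⬝ᵥ (A *ᵥ x)).im = 0 := hA.im_star_dotProduct_mulVec_self x
  rw [h1, zero_add, dotProduct, Complex.im_sum, Finset.mul_sum]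
  refine Finset.sum_le_sum fun j _ => ?_
  have : (star x j * (diagonal c *ᵥ x) j).im = (c j).im * Complex.normSq (x j) := by
    rw [mulVec_diagonal]
    simp [Complex.normSq_apply]
    ring
  rw [this]
  exact mul_le_mul_of_nonneg_right (hc j) (Complex.normSq_nonneg _)

lemma det_ne_zero_of {A : Matrix ι ι ℂ} (hA : A.IsHermitian) {c : ι → ℂ} {δ : ℝ} (hδ : 0 < δ)
    (hc : ∀ j, δ ≤ (c j).im) : (A + diagonal c).det ≠ 0 := by
  intro h
  obtain ⟨x, hx0, hx⟩ := Matrix.exists_mulVec_eq_zero_iff.2 h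
  have := im_quad hA hc x
  rw [hx] at this
  simp only [dotProduct_zero, Complex.zero_im] at this
  apply hx0
  have hs : ∑ j, Complex.normSq (x j) ≤ 0 := by
    by_contra hh
    push Not at hh
    have := mul_pos hδ hh
    linarith
  have hs' := (Finset.sum_eq_zero_iff_of_nonneg (fun j _ => Complex.normSq_nonneg (x j))).1
    (le_antisymm hs (Finset.sum_nonneg fun j _ => Complex.normSq_nonneg (x j)))
  ext j
  exact Complex.normSq_eq_zero.1 (hs' j (Finset.mem_univ j))

lemma inv_entry_le {A : Matrix ι ι ℂ} (hA : A.IsHermitian) {c : ι → ℂ} {δ : ℝ} (hδ : 0 < δ)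
    (hc : ∀ j, δ ≤ (c j).im) (j k : ι) : ‖(A + diagonal c)⁻¹ j k‖ ≤ 1 / δ := by
  set D := A + diagonal c with hD
  have hdet : IsUnit D.det := (det_ne_zero_of hA hδ hc).isUnit
  set x : ι → ℂ := D⁻¹ *ᵥ Pi.single k 1 with hx
  have hDx : D *ᵥ x = Pi.single k 1 := by
    rw [hx, mulVec_mulVec, mul_nonsing_inv _ hdet, one_mulVec]
  have hxj : ∀ j, D⁻¹ j k = x j := by
    intro j
    simp [hx]
  rw [hxj]
  have hq := im_quad hA hc x
  rw [← hD, hDx] at hq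
  simp only [dotProduct_single, mul_one, Pi.star_apply] at hq
  have hq2 : (star (x k)).im ≤ ‖x k‖ := by
    have := (le_abs_self _).trans (Complex.abs_im_le_norm (star (x k)))
    simpa using this
  have hle : ∀ i, δ * ‖x i‖ ^ 2 ≤ ‖x k‖ := by
    intro i
    have : Complex.normSq (x i) ≤ ∑ j, Complex.normSq (x j) :=
      Finset.single_le_sum (f := fun j => Complex.normSq (x j))
        (fun j _ => Complex.normSq_nonneg _) (Finset.mem_univ i)
    rw [Complex.normSq_eq_norm_sq] at this
    have := mul_le_mul_of_nonneg_left this hδ.le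
    linarith
  have hk : δ * ‖x k‖ ≤ 1 := by
    by_contra hh
    push Not at hh
    have h1 := hle k
    have h0 : 0 < ‖x k‖ := by
      by_contra h0
      have : ‖x k‖ = 0 := le_antisymm (not_lt.1 h0) (norm_nonneg _)
      rw [this] at hh
      linarith
    nlinarith
  have hj := hle j
  rw [le_div_iff₀ hδ]
  have h2 : (‖x j‖ * δ) ^ 2 ≤ 1 := by nlinarith
  have h3 : 0 ≤ ‖x j‖ * δ := by positivity
  nlinarith

lemma ratio_bound {A : Matrix ι ι ℂ} (hA : A.IsHermitian) (t : ℂ) {c : ι → ℂ} {δ : ℝ} (hδ : 0 < δ)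
    (hc : ∀ j, δ ≤ (c j).im) :
    ‖(A + diagonal (fun j => t + c j)).det / (A + diagonal c).det‖
      ≤ (Fintype.card ι).factorial • (1 + ‖t‖ * (1 / δ)) ^ Fintype.card ι := by
  set D := A + diagonal c with hD
  have hdet : IsUnit D.det := (det_ne_zero_of hA hδ hc).isUnit
  have e1 : A + diagonal (fun j => t + c j) = D + t • (1 : Matrix ι ι ℂ) := by
    rw [hD, ← diagonal_one, ← diagonal_smul, add_assoc, diagonal_add]
    congr 2
    ext j
    simp [add_comm]
  have e2 : (A + diagonal (fun j => t + c j)).det / D.det = (1 + t • D⁻¹).det := by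
    rw [div_eq_iff hdet.ne_zero, ← det_mul, add_mul, smul_mul_assoc, nonsing_inv_mul _ hdet,
      one_mul, e1]
  rw [e2]
  refine Matrix.det_le (abv := NormedField.toAbsoluteValue ℂ) ?_
  intro i j
  change ‖(1 + t • D⁻¹) i j‖ ≤ _
  rw [Matrix.add_apply, Matrix.smul_apply, smul_eq_mul]
  refine (norm_add_le _ _).trans ?_
  rw [norm_mul]
  gcongr
  · rw [one_apply]; split_ifs <;> simp
  · exact inv_entry_le hA hδ hc i j

end mats

lemma lap_herm {d : ℕ} (Λ : Finset (Fin d → ℤ)) : (lap Λ).IsHermitian := by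
  ext j k
  rw [conjTranspose_apply]
  have hs : ∀ x y : Fin d → ℤ, dist1 x y = dist1 y x := by
    intro x y
    unfold dist1
    simp_rw [abs_sub_comm]
  unfold lap lapE
  rw [hs (k : Fin d → ℤ) j]
  by_cases h : (j : Fin d → ℤ) = k
  · rw [h]
    simp [apply_ite]
  · simp [h, Ne.symm h, apply_ite, eq_comm]

lemma differentiable_prod_aux {ι κ : Type*} [Fintype κ] (s : Finset ι) (f : ι → (κ → ℂ) → ℂ)
    (h : ∀ i, Differentiable ℂ (f i)) : Differentiable ℂ fun w => ∏ i ∈ s, f i w := by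
  classical
  induction s using Finset.induction_on with
  | empty => simp
  | insert a s ha ih =>
    simp_rw [Finset.prod_insert ha]
    exact (h a).mul ih

/-- Theorem 2.6, non-negatively correlated Lloyd model, generating
function. Let `T` be a symmetric matrix on the cube `Λ` with `T jk ≥ 0` and
`∑_j T jk > 0` for all `k`, let `V_j = ∑_k T jk W_k` with `{W_k}` i.i.d. standard Cauchy
and `H_Λ = -Δ + λV`. Then `lim_{ε→0⁺} 𝔼[det((E+iε)1 - H_Λ)/det((Ẽ+iε)1 - H_Λ)]
= det(E·1 + iλT̂ - H₀)/det(Ẽ·1 + iλT̂ - H₀)`, where `H₀ = -Δ` and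
`T̂ = diag(∑_k T jk)`. -/
theorem correlated_lloyd_generating_function (d L : ℕ) (hd : 1 ≤ d)
    (lam : ℝ) (hlam : 0 < lam) (E Etil : ℝ)
    (T : Matrix (cube d L) (cube d L) ℝ) (hT : T.IsSymm)
    (hTpos : ∀ j k, 0 ≤ T j k) (hTsum : ∀ k, 0 < ∑ j, T j k) :
    Tendsto
      (fun ε : ℝ =>
        ∫ W : ↥(cube d L) → ℝ,
          Matrix.det ((((E : ℂ) + ε * Complex.I) • (1 : Matrix (cube d L) (cube d L) ℂ)) -
              (-(lap (cube d L)) +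
                Matrix.diagonal (fun j => (lam : ℂ) * ((∑ k, T j k * W k : ℝ) : ℂ)))) /
          Matrix.det ((((Etil : ℂ) + ε * Complex.I) • (1 : Matrix (cube d L) (cube d L) ℂ)) -
              (-(lap (cube d L)) +
                Matrix.diagonal (fun j => (lam : ℂ) * ((∑ k, T j k * W k : ℝ) : ℂ))))
          ∂(Measure.pi fun _ => cauchy))
      (nhdsWithin 0 (Set.Ioi 0))
      (nhds
        (Matrix.det ((E : ℂ) • (1 : Matrix (cube d L) (cube d L) ℂ) +
            (Complex.I * lam) • Matrix.diagonal (fun j => ((∑ k, T j k : ℝ) : ℂ)) -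
            (-(lap (cube d L)))) /
         Matrix.det ((Etil : ℂ) • (1 : Matrix (cube d L) (cube d L) ℂ) +
            (Complex.I * lam) • Matrix.diagonal (fun j => ((∑ k, T j k : ℝ) : ℂ)) -
            (-(lap (cube d L)))))) := by
  have hrow : ∀ j, 0 < ∑ k, T j k := by
    intro j
    have := hTsum j
    simp_rw [fun i => hT.apply j i] at this
    exact this
  -- diagonal vector
  let cc : ℂ → (↥(cube d L) → ℂ) → ↥(cube d L) → ℂ :=
    fun z w j => z - (lam : ℂ) * ∑ k, (T j k : ℂ) * w k
  have hA := lap_herm (cube d L)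
  have hM : ∀ (z : ℂ) (W : ↥(cube d L) → ℝ),
      (z • (1 : Matrix (cube d L) (cube d L) ℂ)) - (-(lap (cube d L)) +
        Matrix.diagonal (fun j => (lam : ℂ) * ((∑ k, T j k * W k : ℝ) : ℂ)))
        = lap (cube d L) + diagonal (cc z (fun k => (W k : ℂ))) := by
    intro z W
    have : diagonal (cc z (fun k => (W k : ℂ))) = z • (1 : Matrix (cube d L) (cube d L) ℂ) -
        Matrix.diagonal (fun j => (lam : ℂ) * ((∑ k, T j k * W k : ℝ) : ℂ)) := by
      rw [smul_one_eq_diagonal, diagonal_sub]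
      congr 1
      ext j
      simp [cc]
    rw [this]
    abel
  have hN : ∀ (z : ℂ), z • (1 : Matrix (cube d L) (cube d L) ℂ) +
            (Complex.I * lam) • Matrix.diagonal (fun j => ((∑ k, T j k : ℝ) : ℂ)) -
            (-(lap (cube d L))) = lap (cube d L) + diagonal (cc z (fun _ => -Complex.I)) := by
    intro z
    have : diagonal (cc z (fun _ => -Complex.I)) = z • (1 : Matrix (cube d L) (cube d L) ℂ) +
        (Complex.I * lam) • Matrix.diagonal (fun j => ((∑ k, T j k : ℝ) : ℂ)) := by
      rw [smul_one_eq_diagonal, ← diagonal_smul, diagonal_add]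
      congr 1
      ext j
      simp only [cc, Pi.smul_apply, smul_eq_mul]
      push_cast
      rw [← Finset.sum_mul]
      ring
    rw [this]
    abel
  have hreal : ∀ (e ε : ℝ) (w : ↥(cube d L) → ℂ) (j), (cc ((e : ℂ) + ε * Complex.I) w j).im
      = ε - lam * ∑ k, T j k * (w k).im := by
    intro e ε w j
    simp [cc, Complex.mul_im]
  have him : ∀ (e ε : ℝ) (w : ↥(cube d L) → ℂ), (∀ k, (w k).im ≤ 0) →
      ∀ j, ε ≤ (cc ((e : ℂ) + ε * Complex.I) w j).im := by
    intro e ε w hw j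
    rw [hreal]
    have : ∑ k, T j k * (w k).im ≤ 0 :=
      Finset.sum_nonpos fun k _ => mul_nonpos_of_nonneg_of_nonpos (hTpos j k) (hw k)
    nlinarith
  have hdiff : ∀ z : ℂ, Differentiable ℂ fun w : ↥(cube d L) → ℂ =>
      (lap (cube d L) + diagonal (cc z w)).det := by
    intro z
    simp only [det_apply, Matrix.add_apply, diagonal_apply, cc]
    refine Differentiable.fun_sum fun σ _ => ?_
    refine Differentiable.const_smul ?_ _
    apply differentiable_prod_aux
    intro i
    apply Differentiable.const_add
    split_ifs <;> fun_prop
  simp_rw [hM, hN]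
  -- continuity in z
  have hz : Continuous fun z : ℂ => (lap (cube d L) + diagonal (cc z (fun _ => -Complex.I))).det := by
    apply Continuous.matrix_det
    refine continuous_const.add (Continuous.matrix_diagonal ?_)
    simp only [cc]
    fun_prop
  have hden : (lap (cube d L) + diagonal (cc (Etil : ℂ) (fun _ => -Complex.I))).det ≠ 0 := by
    obtain ⟨δ, hδ, hδ'⟩ : ∃ δ : ℝ, 0 < δ ∧ ∀ j, δ ≤ lam * ∑ k, T j k := by
      rcases isEmpty_or_nonempty ↥(cube d L) with h | h
      · exact ⟨1, one_pos, fun j => h.elim j⟩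
      · obtain ⟨j0, hj0⟩ := Finite.exists_min (fun j => lam * ∑ k, T j k)
        exact ⟨_, mul_pos hlam (hrow j0), hj0⟩
    refine det_ne_zero_of hA hδ ?_
    intro j
    have := hreal Etil 0 (fun _ => -Complex.I) j
    simp only [Complex.ofReal_zero, zero_mul, add_zero] at this
    rw [this]
    simpa using hδ' j
  have hlim : ∀ e : ℝ, Tendsto (fun ε : ℝ => (e : ℂ) + ε * Complex.I) (nhdsWithin 0 (Set.Ioi 0))
      (nhds (e : ℂ)) := by
    intro e
    have : Continuous (fun ε : ℝ => (e : ℂ) + ε * Complex.I) := by fun_prop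
    have h := this.tendsto 0
    simp only [Complex.ofReal_zero, zero_mul, add_zero] at h
    exact h.mono_left nhdsWithin_le_nhds
  have hfin := ((hz.tendsto (E : ℂ)).comp (hlim E)).div ((hz.tendsto (Etil : ℂ)).comp (hlim Etil)) hden
  refine hfin.congr' ?_
  filter_upwards [self_mem_nhdsWithin] with ε hε
  symm
  have hε' : 0 < ε := hε
  refine cauchy_mean_pi
    (F := fun w => (lap (cube d L) + diagonal (cc ((E : ℂ) + ε * Complex.I) w)).det /
      (lap (cube d L) + diagonal (cc ((Etil : ℂ) + ε * Complex.I) w)).det)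
    (U := {w | (lap (cube d L) + diagonal (cc ((Etil : ℂ) + ε * Complex.I) w)).det ≠ 0})
    (isOpen_ne_fun (hdiff _).continuous continuous_const)
    (fun w hw => det_ne_zero_of hA hε' (him _ _ w hw))
    (by
      simp_rw [div_eq_mul_inv]
      exact (hdiff _).differentiableOn.fun_mul ((hdiff _).differentiableOn.fun_inv (fun w hw => hw)))
    (fun w hw => ?_) (C := (Fintype.card ↥(cube d L)).factorial •
      (1 + ‖(E : ℂ) - Etil‖ * (1 / ε)) ^ Fintype.card ↥(cube d L))
  have := ratio_bound hA ((E : ℂ) - Etil) hε' (him Etil ε w hw)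
  convert this using 6
  ext j
  simp only [cc]
  ring
end
end

section
/- Let d ≥ 1, let Λ ⊂ ℤ^d be a finite cube, let λ > 0 and E ∈ ℝ. Let T ∈ ℝ^{Λ×Λ} be symmetric with T_{jk} ≥ 0 for all j,k and Σ_j T_{jk} > 0 for every k. Let {W_k}_{k∈Λ} be i.i.d. standard Cauchy, V_j = Σ_k T_{jk} W_k, and H_Λ = −Δ + λV. Then lim_{ε→0⁺} E[ Tr ((E+iε)·1_Λ − H_Λ)^{−1} ] = Tr (E·1_Λ + iλT̂ − H₀)^{−1}, where H₀ = −Δ and T̂_{jj} = Σ_k T_{jk}. In particular the non-negatively correlated Lloyd model has the same averaged density of states as the free Laplacian H₀ with imaginary mass matrix λT̂. -/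
open MeasureTheory Matrix Filter

noncomputable section

lemma dslope_diff {f : ℂ → ℂ} (hf : ∀ z : ℂ, z.im ≤ 0 → DifferentiableAt ℂ f z) (z : ℂ)
    (hz : z.im ≤ 0) : DifferentiableAt ℂ (dslope f (-Complex.I)) z := by
  by_cases h : z = -Complex.I
  · subst h
    have hs : {w : ℂ | w.im < 0} ∈ nhds (-Complex.I) :=
      (isOpen_lt Complex.continuous_im continuous_const).mem_nhds (by simp)
    exact ((Complex.differentiableOn_dslope hs).2
      (fun w hw => (hf w (le_of_lt hw)).differentiableWithinAt)).differentiableAt hs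
  · exact (differentiableAt_dslope_of_ne h).2 (hf z hz)

lemma ker_eq (f : ℂ → ℂ) (w : ℂ) (h : w ≠ -Complex.I) :
    dslope f (-Complex.I) w / (w - Complex.I) = (f w - f (-Complex.I)) / (w ^ 2 + 1) := by
  rw [dslope_of_ne _ h, slope_def_field, div_div]
  congr 1
  linear_combination (-1 : ℂ) * Complex.I_sq

lemma ker_bound {f : ℂ → ℂ} {C : ℝ} (hC : ∀ z : ℂ, z.im ≤ 0 → ‖f z‖ ≤ C) {R : ℝ} (hR : 2 ≤ R)
    {w : ℂ} (hw : w.im ≤ 0) (hwR : R ≤ ‖w‖) :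
    ‖dslope f (-Complex.I) w / (w - Complex.I)‖ ≤ 4 * C / R ^ 2 := by
  have hne : w ≠ -Complex.I := by
    rintro rfl
    simp at hwR
    linarith
  rw [ker_eq f w hne, norm_div]
  have h1 : ‖f w - f (-Complex.I)‖ ≤ 2 * C :=
    (norm_sub_le _ _).trans (by linarith [hC w hw, hC (-Complex.I) (by simp)])
  have h2 : R ^ 2 / 2 ≤ ‖w ^ 2 + 1‖ := by
    have := norm_sub_le (w ^ 2 + 1) 1
    simp only [add_sub_cancel_right, norm_pow, norm_one] at this
    nlinarith
  have hC0 : 0 ≤ C := (norm_nonneg _).trans (hC 0 (by simp))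
  calc _ ≤ 2 * C / (R ^ 2 / 2) := by gcongr
    _ = _ := by field_simp; ring

lemma top_bound {f : ℂ → ℂ} (hf : ∀ z : ℂ, z.im ≤ 0 → DifferentiableAt ℂ f z) {C : ℝ}
    (hC : ∀ z : ℂ, z.im ≤ 0 → ‖f z‖ ≤ C) {R : ℝ} (hR : 2 ≤ R) :
    ‖∫ x in (-R)..R, dslope f (-Complex.I) (x : ℂ) / ((x : ℂ) - Complex.I)‖ ≤ 16 * C / R := by
  set g : ℂ → ℂ := fun w => dslope f (-Complex.I) w / (w - Complex.I) with hg
  have hd : ∀ w : ℂ, w.im ≤ 0 → DifferentiableAt ℂ g w := by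
    intro w hw
    refine (dslope_diff hf w hw).div (by fun_prop) ?_
    intro h
    have := congrArg Complex.im h
    simp at this
    linarith
  have key := Complex.integral_boundary_rect_eq_zero_of_differentiableOn g
    (⟨-R, -R⟩ : ℂ) (⟨R, 0⟩ : ℂ) (by
      intro w hw
      refine (hd w ?_).differentiableWithinAt
      have := hw.2
      simp only [Set.mem_preimage] at this
      rw [Set.uIcc_of_le (by linarith)] at this
      exact this.2)
  simp only [Complex.ofReal_zero, zero_mul, add_zero, smul_eq_mul] at key
  have b1 : ‖∫ x in (-R)..R, g (x + ((-R : ℝ) : ℂ) * Complex.I)‖ ≤ 4 * C / R ^ 2 * |R - -R| := by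
    apply intervalIntegral.norm_integral_le_of_norm_le_const
    intro x _
    apply ker_bound hC hR
    · simp; linarith
    · refine le_trans ?_ (Complex.abs_im_le_norm _)
      simp
      exact le_abs_self R
  have b2 : ‖∫ y in (-R)..0, g ((R : ℂ) + y * Complex.I)‖ ≤ 4 * C / R ^ 2 * |0 - -R| := by
    apply intervalIntegral.norm_integral_le_of_norm_le_const
    intro x hx
    rw [Set.uIoc_of_le (by linarith)] at hx
    apply ker_bound hC hR
    · simpa using hx.2
    · refine le_trans ?_ (Complex.abs_re_le_norm _)
      simp
      exact le_abs_self R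
  have b3 : ‖∫ y in (-R)..0, g (((-R : ℝ) : ℂ) + y * Complex.I)‖ ≤ 4 * C / R ^ 2 * |0 - -R| := by
    apply intervalIntegral.norm_integral_le_of_norm_le_const
    intro x hx
    rw [Set.uIoc_of_le (by linarith)] at hx
    apply ker_bound hC hR
    · simpa using hx.2
    · refine le_trans ?_ (Complex.abs_re_le_norm _)
      simp
      exact le_abs_self R
  have e1 : |R - -R| = 2 * R := by rw [abs_of_nonneg] <;> linarith
  have e2 : |0 - -R| = R := by rw [abs_of_nonneg] <;> linarith
  rw [e1] at b1
  rw [e2] at b2 b3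
  have : (∫ x in (-R)..R, g x) = (∫ x in (-R)..R, g (x + ((-R : ℝ) : ℂ) * Complex.I))
      + Complex.I * (∫ y in (-R)..0, g ((R : ℂ) + y * Complex.I))
      - Complex.I * (∫ y in (-R)..0, g (((-R : ℝ) : ℂ) + y * Complex.I)) := by
    linear_combination -key
  change ‖∫ x in (-R)..R, g x‖ ≤ _
  rw [this]
  refine (norm_sub_le _ _).trans ?_
  refine (add_le_add_left (norm_add_le _ _) _).trans ?_
  simp only [norm_mul, Complex.norm_I, one_mul]
  refine (add_le_add (add_le_add b1 b2) b3).trans (le_of_eq ?_)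
  field_simp
  ring

lemma cauchy_integral {f : ℂ → ℂ} (hf : ∀ z : ℂ, z.im ≤ 0 → DifferentiableAt ℂ f z) {C : ℝ}
    (hC : ∀ z : ℂ, z.im ≤ 0 → ‖f z‖ ≤ C) : ∫ x : ℝ, f x ∂cauchy = f (-Complex.I) := by
  have hcont : Continuous (fun x : ℝ => f x) := by
    rw [continuous_iff_continuousAt]
    intro x
    exact ContinuousAt.comp (f := fun x : ℝ => (x : ℂ)) (hf x (by simp)).continuousAt
      Complex.continuous_ofReal.continuousAt
  have hI : Integrable (fun x : ℝ => (1 + x ^ 2)⁻¹) := integrable_inv_one_add_sq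
  have hI' : Integrable (fun x : ℝ => (((1 + x ^ 2)⁻¹ : ℝ) : ℂ)) := hI.ofReal
  have i1 : Integrable (fun x : ℝ => f x * (((1 + x ^ 2)⁻¹ : ℝ) : ℂ)) :=
    hI'.bdd_mul (c := C) hcont.aestronglyMeasurable (Eventually.of_forall fun x => hC x (by simp))
  have i2 : Integrable (fun x : ℝ => f (-Complex.I) * (((1 + x ^ 2)⁻¹ : ℝ) : ℂ)) :=
    hI'.const_mul _
  have heq : ∀ x : ℝ, dslope f (-Complex.I) (x : ℂ) / ((x : ℂ) - Complex.I) =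
      f x * (((1 + x ^ 2)⁻¹ : ℝ) : ℂ) - f (-Complex.I) * (((1 + x ^ 2)⁻¹ : ℝ) : ℂ) := by
    intro x
    rw [ker_eq]
    · push_cast
      rw [← sub_mul, add_comm, div_eq_mul_inv]
    · intro h
      have := congrArg Complex.im h
      simp at this
  have hz : ∫ x : ℝ, (f x * (((1 + x ^ 2)⁻¹ : ℝ) : ℂ)
      - f (-Complex.I) * (((1 + x ^ 2)⁻¹ : ℝ) : ℂ)) = 0 := by
    have t1 := intervalIntegral_tendsto_integral (i1.sub i2) tendsto_neg_atTop_atBot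
      (tendsto_id (α := ℝ) (x := atTop))
    refine tendsto_nhds_unique t1 ?_
    have t2 : Tendsto (fun R : ℝ => 16 * C / R) atTop (nhds 0) :=
      tendsto_const_nhds.div_atTop tendsto_id
    refine squeeze_zero_norm' ?_ t2
    filter_upwards [eventually_ge_atTop 2] with R hR
    have := top_bound hf hC hR
    simp only [heq] at this
    exact this
  rw [integral_sub i1 i2, integral_const_mul, integral_complex_ofReal,
    integral_univ_inv_one_add_sq, sub_eq_zero] at hz
  rw [cauchy, integral_withDensity_eq_integral_toReal_smul (by fun_prop) (by simp)]
  have : ∀ x : ℝ, (ENNReal.ofReal (1 / (Real.pi * (1 + x ^ 2)))).toReal • f x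
      = (Real.pi : ℂ)⁻¹ * (f x * (((1 + x ^ 2)⁻¹ : ℝ) : ℂ)) := by
    intro x
    rw [ENNReal.toReal_ofReal (by positivity), Complex.real_smul]
    push_cast
    rw [one_div, mul_inv]
    ring
  simp only [this]
  rw [integral_const_mul, hz]
  have : (Real.pi : ℂ) ≠ 0 := by exact_mod_cast Real.pi_ne_zero
  field_simp

instance cauchy_prob : IsProbabilityMeasure cauchy := by
  constructor
  rw [cauchy, withDensity_apply _ MeasurableSet.univ, Measure.restrict_univ,
    ← ofReal_integral_eq_lintegral_ofReal]
  · have : ∀ x : ℝ, 1 / (Real.pi * (1 + x ^ 2)) = Real.pi⁻¹ * (1 + x ^ 2)⁻¹ := by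
      intro x
      rw [one_div, mul_inv]
    simp only [this]
    rw [integral_const_mul, integral_univ_inv_one_add_sq, inv_mul_cancel₀ Real.pi_ne_zero]
    simp
  · have : ∀ x : ℝ, 1 / (Real.pi * (1 + x ^ 2)) = Real.pi⁻¹ * (1 + x ^ 2)⁻¹ := by
      intro x
      rw [one_div, mul_inv]
    simp only [this]
    exact integrable_inv_one_add_sq.const_mul _
  · exact Eventually.of_forall fun x => by positivity

lemma update_mp {ι : Type*} [Fintype ι] [DecidableEq ι] (i : ι) :
    MeasurePreserving (fun p : (ι → ℝ) × ℝ => Function.update p.1 i p.2)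
      ((Measure.pi fun _ : ι => cauchy).prod cauchy) (Measure.pi fun _ : ι => cauchy) := by
  have hm : Measurable (fun p : (ι → ℝ) × ℝ => Function.update p.1 i p.2) := by
    rw [measurable_pi_iff]
    intro j
    by_cases h : j = i
    · subst h; simpa using measurable_snd
    · simp only [Function.update_of_ne h]
      exact (measurable_pi_apply j).comp measurable_fst
  refine ⟨hm, ?_⟩
  symm
  apply Measure.pi_eq
  intro s hs
  rw [Measure.map_apply hm (MeasurableSet.univ_pi hs)]
  have : (fun p : (ι → ℝ) × ℝ => Function.update p.1 i p.2) ⁻¹' (Set.univ.pi s) =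
      (Set.univ.pi (Function.update s i Set.univ)) ×ˢ (s i) := by
    ext ⟨w, x⟩
    simp only [Set.mem_preimage, Set.mem_pi, Set.mem_univ, true_implies, Set.mem_prod]
    constructor
    · intro h
      refine ⟨fun j => ?_, by simpa using h i⟩
      by_cases hj : j = i
      · subst hj; simp
      · simpa [Function.update_of_ne hj] using h j
    · rintro ⟨h, hx⟩ j
      by_cases hj : j = i
      · subst hj; simpa using hx
      · simpa [Function.update_of_ne hj] using h j
  rw [this, Measure.prod_prod, Measure.pi_pi]
  rw [← Finset.mul_prod_erase Finset.univ (fun j => cauchy (s j)) (Finset.mem_univ i),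
    ← Finset.mul_prod_erase Finset.univ _ (Finset.mem_univ i)]
  simp only [Function.update_self, measure_univ, one_mul]
  rw [mul_comm]
  congr 1
  refine Finset.prod_congr rfl fun j hj => ?_
  rw [Function.update_of_ne (Finset.ne_of_mem_erase hj)]

lemma multi_integral {ι : Type*} [Fintype ι] [DecidableEq ι] {F : (ι → ℂ) → ℂ} {C : ℝ}
    (hF : ∀ w : ι → ℂ, (∀ i, (w i).im ≤ 0) → DifferentiableAt ℂ F w)
    (hC : ∀ w : ι → ℂ, (∀ i, (w i).im ≤ 0) → ‖F w‖ ≤ C) :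
    ∫ W : ι → ℝ, F (fun i => (W i : ℂ)) ∂(Measure.pi fun _ => cauchy)
      = F (fun _ => -Complex.I) := by
  let g : Finset ι → (ι → ℝ) → ι → ℂ := fun s W j => if j ∈ s then -Complex.I else (W j : ℂ)
  have hgim : ∀ s W i, (g s W i).im ≤ 0 := by
    intro s W i
    simp only [g]
    split_ifs <;> simp
  have hgc : ∀ s, Continuous (g s) := by
    intro s
    refine continuous_pi fun j => ?_
    simp only [g]
    split_ifs <;> fun_prop
  have hFg : ∀ s, Continuous (fun W => F (g s W)) := by
    intro s
    rw [continuous_iff_continuousAt]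
    intro W
    exact ContinuousAt.comp (f := g s) (hF _ (hgim s W)).continuousAt (hgc s).continuousAt
  have main : ∀ s : Finset ι, ∫ W : ι → ℝ, F (fun i => (W i : ℂ)) ∂(Measure.pi fun _ => cauchy)
      = ∫ W : ι → ℝ, F (g s W) ∂(Measure.pi fun _ => cauchy) := by
    intro s
    induction s using Finset.induction_on with
    | empty => simp [g]
    | insert i s hi ih =>
      rw [ih]
      have hmp := update_mp i
      rw [← hmp.map_eq, integral_map hmp.measurable.aemeasurable
        (hFg s).aestronglyMeasurable, hmp.map_eq, integral_prod]
      · refine integral_congr_ae (Eventually.of_forall fun W => ?_)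
        have hup : ∀ x : ℝ, g s (Function.update W i x)
            = Function.update (g s W) i (x : ℂ) := by
          intro x
          ext j
          by_cases hj : j = i
          · subst hj; simp [g, hi]
          · simp [g, Function.update_of_ne hj]
        have him : ∀ z : ℂ, z.im ≤ 0 → ∀ j, (Function.update (g s W) i z j).im ≤ 0 := by
          intro z hz j
          by_cases hj : j = i
          · subst hj; simpa using hz
          · simpa [Function.update_of_ne hj] using hgim s W j
        have hins : g (insert i s) W = Function.update (g s W) i (-Complex.I) := by
          ext j
          by_cases hj : j = i
          · subst hj; simp [g]
          · simp [g, Function.update_of_ne hj, hj]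
        simp only [hup]
        rw [hins]
        refine cauchy_integral (f := fun z => F (Function.update (g s W) i z)) (C := C) ?_ ?_
        · intro z hz
          refine DifferentiableAt.comp (g := F) z (hF _ (him z hz)) ?_
          rw [differentiableAt_pi]
          intro j
          by_cases hj : j = i
          · subst hj; simp
          · simp [Function.update_of_ne hj]
        · intro z hz
          exact hC _ (him z hz)
      · refine Integrable.of_bound (C := C) ?_ (Eventually.of_forall fun p => hC _ (hgim _ _))
        exact (hFg s).measurable.comp hmp.measurable |>.aestronglyMeasurable
  rw [main Finset.univ]
  simp [g]

lemma im_form {ι : Type*} [Fintype ι] [DecidableEq ι] {K : Matrix ι ι ℂ} (hK : K.IsHermitian)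
    (a v : ι → ℂ) : (star v ⬝ᵥ ((K + diagonal a) *ᵥ v)).im = ∑ j, (a j).im * ‖v j‖ ^ 2 := by
  rw [add_mulVec, dotProduct_add, Complex.add_im]
  have h1 : (star v ⬝ᵥ (K *ᵥ v)).im = 0 := by
    have := hK.im_star_dotProduct_mulVec_self v
    simpa using this
  rw [h1, zero_add, dotProduct, Complex.im_sum]
  refine Finset.sum_congr rfl fun j _ => ?_
  rw [mulVec_diagonal, Pi.star_apply, ← Complex.normSq_eq_norm_sq, Complex.normSq_apply]
  simp
  ring

lemma det_ne {ι : Type*} [Fintype ι] [DecidableEq ι] {K : Matrix ι ι ℂ} (hK : K.IsHermitian)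
    (a : ι → ℂ) (ha : ∀ j, 0 < (a j).im) : IsUnit (K + diagonal a).det := by
  rw [isUnit_iff_ne_zero]
  intro h
  obtain ⟨v, hv, h0⟩ := Matrix.exists_mulVec_eq_zero_iff.2 h
  have := im_form hK a v
  rw [h0, dotProduct_zero, Complex.zero_im] at this
  apply hv
  ext j
  have hz := (Finset.sum_eq_zero_iff_of_nonneg
    (fun j _ => mul_nonneg (ha j).le (sq_nonneg ‖v j‖))).1 this.symm j (Finset.mem_univ j)
  simpa [(ha j).ne'] using hz

lemma inv_bound {ι : Type*} [Fintype ι] [DecidableEq ι] {K : Matrix ι ι ℂ} (hK : K.IsHermitian)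
    (a : ι → ℂ) {ε : ℝ} (hε : 0 < ε) (ha : ∀ j, ε ≤ (a j).im) :
    ‖trace ((K + diagonal a)⁻¹)‖ ≤ Fintype.card ι * ε⁻¹ := by
  have hu := det_ne hK a (fun j => hε.trans_le (ha j))
  rw [trace]
  refine (norm_sum_le _ _).trans ?_
  refine (Finset.sum_le_card_nsmul _ _ ε⁻¹ ?_).trans (by simp)
  intro j _
  set v : ι → ℂ := (K + diagonal a)⁻¹ *ᵥ (Pi.single j 1) with hv
  have hvj : v j = (K + diagonal a)⁻¹ j j := by simp [hv]
  have hAv : (K + diagonal a) *ᵥ v = Pi.single j 1 := by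
    rw [hv, mulVec_mulVec, Matrix.mul_nonsing_inv _ hu, one_mulVec]
  have h := im_form hK a v
  rw [hAv, dotProduct_single] at h
  have h1 : ε * ‖v j‖ ^ 2 ≤ ∑ j, (a j).im * ‖v j‖ ^ 2 :=
    (mul_le_mul_of_nonneg_right (ha j) (sq_nonneg _)).trans
      (Finset.single_le_sum (f := fun j => (a j).im * ‖v j‖ ^ 2)
      (fun k _ => mul_nonneg (hε.le.trans (ha k)) (sq_nonneg _)) (Finset.mem_univ j))
  rw [← h] at h1
  have h2 : (star v j * 1).im ≤ ‖v j‖ := by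
    refine (le_abs_self _).trans ((Complex.abs_im_le_norm _).trans ?_)
    simp
  have h3 := h1.trans h2
  rw [diag_apply, ← hvj]
  rcases (norm_nonneg (v j)).eq_or_lt with h0 | h0
  · rw [← h0]; positivity
  · rw [← one_div, le_div_iff₀ hε]
    nlinarith

section
attribute [local instance] Matrix.linftyOpNormedRing Matrix.linftyOpNormedAlgebra

lemma trace_inv_diff {ι : Type*} [Fintype ι] [DecidableEq ι] (K : Matrix ι ι ℂ)
    (a : ι → ℂ) (hu : IsUnit (K + diagonal a).det) :
    DifferentiableAt ℂ (fun b : ι → ℂ => trace ((K + diagonal b)⁻¹)) a := by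
  have h1 : DifferentiableAt ℂ (fun b : ι → ℂ => K + diagonal b) a := by
    have : Differentiable ℂ (fun b : ι → ℂ => diagonal b) :=
      (LinearMap.toContinuousLinearMap (Matrix.diagonalLinearMap ι ℂ ℂ)).differentiable
    exact (this a).const_add K
  have h2 := (differentiableAt_inverse (𝕜 := ℂ)
    ((Matrix.isUnit_iff_isUnit_det _).2 hu)).comp a h1
  have h3 := (LinearMap.toContinuousLinearMap (Matrix.traceLinearMap ι ℂ ℂ)).differentiableAt.comp
    a h2
  refine h3.congr_of_eventuallyEq (Eventually.of_forall fun b => ?_)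
  simp [Matrix.nonsing_inv_eq_ringInverse]
end

/-- Theorem 2.6, non-negatively correlated Lloyd model, averaged Green's
function. With `V_j = ∑_k T jk W_k`, `{W_k}` i.i.d. standard Cauchy, `T` symmetric with
non-negative entries and positive column sums, and `H_Λ = -Δ + λV`, one has
`lim_{ε→0⁺} 𝔼[Tr((E+iε)1 - H_Λ)⁻¹] = Tr(E·1 + iλT̂ - H₀)⁻¹` with `H₀ = -Δ` and
`T̂ = diag(∑_k T jk)`: the correlated Lloyd model has the same averaged density of
states as the free Laplacian with imaginary mass matrix `λT̂`. -/
theorem correlated_lloyd_averaged_green (d L : ℕ) (hd : 1 ≤ d)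
    (lam : ℝ) (hlam : 0 < lam) (E : ℝ)
    (T : Matrix (cube d L) (cube d L) ℝ) (hT : T.IsSymm)
    (hTpos : ∀ j k, 0 ≤ T j k) (hTsum : ∀ k, 0 < ∑ j, T j k) :
    Tendsto
      (fun ε : ℝ =>
        ∫ W : ↥(cube d L) → ℝ,
          Matrix.trace
            (((((E : ℂ) + ε * Complex.I) • (1 : Matrix (cube d L) (cube d L) ℂ)) -
              (-(lap (cube d L)) +
                Matrix.diagonal (fun j => (lam : ℂ) * ((∑ k, T j k * W k : ℝ) : ℂ))))⁻¹)
          ∂(Measure.pi fun _ => cauchy))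
      (nhdsWithin 0 (Set.Ioi 0))
      (nhds
        (Matrix.trace
          (((E : ℂ) • (1 : Matrix (cube d L) (cube d L) ℂ) +
            (Complex.I * lam) • Matrix.diagonal (fun j => ((∑ k, T j k : ℝ) : ℂ)) -
            (-(lap (cube d L))))⁻¹))) := by
  have hrow : ∀ j, 0 < ∑ k, T j k := by
    intro j
    have := hTsum j
    simpa only [hT.apply] using this
  have hK := lap_herm (cube d L)
  set K := lap (cube d L) with hKdef
  let a : ℝ → (cube d L → ℂ) → cube d L → ℂ := fun ε w j =>
    (E : ℂ) + ε * Complex.I - lam * ∑ k, (T j k : ℂ) * w k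
  have haim : ∀ ε w j, (a ε w j).im = ε - lam * ∑ k, T j k * (w k).im := by
    intro ε w j
    simp [a]
  have key : ∀ ε : ℝ, 0 < ε → ∫ W : ↥(cube d L) → ℝ,
          Matrix.trace
            (((((E : ℂ) + ε * Complex.I) • (1 : Matrix (cube d L) (cube d L) ℂ)) -
              (-K +
                Matrix.diagonal (fun j => (lam : ℂ) * ((∑ k, T j k * W k : ℝ) : ℂ))))⁻¹)
          ∂(Measure.pi fun _ => cauchy) = trace ((K + diagonal (a ε fun _ => -Complex.I))⁻¹) := by
    intro ε hε
    have hge : ∀ w : cube d L → ℂ, (∀ i, (w i).im ≤ 0) → ∀ j, ε ≤ (a ε w j).im := by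
      intro w hw j
      rw [haim]
      have : ∑ k, T j k * (w k).im ≤ 0 :=
        Finset.sum_nonpos fun k _ => mul_nonpos_of_nonneg_of_nonpos (hTpos j k) (hw k)
      nlinarith
    rw [← multi_integral (F := fun w => trace ((K + diagonal (a ε w))⁻¹))
      (C := Fintype.card (cube d L) * ε⁻¹)]
    · congr 1
      ext W
      congr 2
      ext j k
      by_cases h : j = k
      · subst h
        simp [a]
        ring
      · simp [h]
    · intro w hw
      refine DifferentiableAt.comp (g := fun b => trace ((K + diagonal b)⁻¹)) w
        (trace_inv_diff K _ (det_ne hK _ fun j => hε.trans_le (hge w hw j))) ?_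
      rw [differentiableAt_pi]
      intro j
      simp only [a]
      fun_prop
    · intro w hw
      exact inv_bound hK _ hε (hge w hw)
  have hlim : ((E : ℂ) • (1 : Matrix (cube d L) (cube d L) ℂ) +
            (Complex.I * lam) • Matrix.diagonal (fun j => ((∑ k, T j k : ℝ) : ℂ)) -
            (-K)) = K + diagonal (a 0 fun _ => -Complex.I) := by
    ext j k
    by_cases h : j = k
    · subst h
      simp [a, ← Finset.sum_mul]
      ring
    · simp [h]
  rw [hlim]
  have hca : ContinuousAt (fun ε : ℝ => trace ((K + diagonal (a ε fun _ => -Complex.I))⁻¹)) 0 := by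
    refine ContinuousAt.comp (g := fun b => trace ((K + diagonal b)⁻¹))
      (f := fun ε : ℝ => a ε fun _ => -Complex.I)
      (trace_inv_diff K _ (det_ne hK _ fun j => ?_)).continuousAt ?_
    · rw [haim]
      simpa using mul_pos hlam (hrow j)
    · refine Continuous.continuousAt (continuous_pi fun j => ?_)
      simp only [a]
      fun_prop
  refine (hca.tendsto.mono_left nhdsWithin_le_nhds).congr' ?_
  filter_upwards [self_mem_nhdsWithin] with ε hε
  exact (key ε hε).symm
end
end
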